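/- Let π = ∏_{j=1}^{m} t_{k_j}^{i_{k_j}} (m ≥ 1) be a standard OGS elementary element of S_n, i.e. 2 ≤ k_1 < k_2 < ⋯ < k_m ≤ n, 0 < i_{k_j} < k_j for each j, and Σ_{j=1}^{m} i_{k_j} ≤ k_1. Then the descent set of π is the singleton des(π) = {Σ_{j=1}^{m} i_{k_j}}; equivalently, for 1 ≤ r ≤ n−1, ℓ(s_r·π) = ℓ(π)−1 if r = Σ_{j=1}^{m} i_{k_j}, and ℓ(s_r·π) = ℓ(π)+1 otherwise. -/

import Mathlib

/-!
Setup for the symmetric group `Sₙ`, realized as `Equiv.Perm (Fin n)` with `Fin n`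
encoding `{1, …, n}` (0-indexed positions).  The paper multiplies permutations
left-to-right: `(π·σ)(i) = σ(π(i))`, while Mathlib composes right-to-left:
`(π * σ) i = π (σ i)`.  Hence a paper product `a₁ · a₂ ⋯ a_k` is encoded as the
Mathlib product `a_k * ⋯ * a₂ * a₁` (the leftmost paper factor acts first).
-/

open Equiv Finset

/-- The adjacent transposition `sᵢ` (1-indexed values): the transposition `(i, i+1)`,
as a permutation of `Fin n`; junk value `1` outside the range `1 ≤ i ≤ n-1`. -/
def sP (n : ℕ) (i : ℕ) : Equiv.Perm (Fin n) :=
  if h : i < n then Equiv.swap ⟨i - 1, by omega⟩ ⟨i, h⟩ else 1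

/-- `tₘ = s₁·s₂⋯s_{m−1}` (left-to-right), i.e. the `m`-cycle sending `1 ↦ m` and
`j ↦ j−1` for `2 ≤ j ≤ m` (1-indexed), fixing every `j > m`; `t₁ = 1`. -/
def tP (n : ℕ) (m : ℕ) : Equiv.Perm (Fin n) :=
  if h : m - 1 < n then ((⟨m - 1, h⟩ : Fin n).cycleRange)⁻¹ else 1

/-- The paper's left-to-right product `f a · f (a+1) ⋯ f b` (increasing indices,
so `f a` acts first), encoded in Mathlib's composition order. -/
def ogsProd {n : ℕ} (a b : ℕ) (f : ℕ → Equiv.Perm (Fin n)) : Equiv.Perm (Fin n) :=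
  ((List.range' a (b + 1 - a)).map f).reverse.prod

/-- The paper's left-to-right product `f b · f (b−1) ⋯ f a` (decreasing indices,
so `f b` acts first), encoded in Mathlib's composition order. -/
def ogsProdDesc {n : ℕ} (a b : ℕ) (f : ℕ → Equiv.Perm (Fin n)) : Equiv.Perm (Fin n) :=
  ((List.range' a (b + 1 - a)).map f).prod

/-- The Coxeter length of `π`: the number of inversions, i.e. of pairs `i < j`
with `π(i) > π(j)`. -/
def len {n : ℕ} (π : Equiv.Perm (Fin n)) : ℕ :=
  (Finset.univ.filter fun p : Fin n × Fin n => p.1 < p.2 ∧ π p.2 < π p.1).card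

/-- The descent set of `π`: the set of 1-indexed positions `i ∈ {1, …, n−1}`
with `π(i) > π(i+1)`. -/
def descents {n : ℕ} (π : Equiv.Perm (Fin n)) : Finset ℕ :=
  (Finset.Ico 1 n).filter fun i => ∃ h : i < n, π ⟨i, h⟩ < π ⟨i - 1, by omega⟩

theorem tP_apply_val {n k : ℕ} (hk1 : 1 ≤ k) (hkn : k ≤ n) (p : Fin n) :
    (tP n k p : ℕ) = if (p : ℕ) < k then (if (p : ℕ) = 0 then k - 1 else p - 1) else p := by
  have h : k - 1 < n := by omega
  obtain ⟨q, rfl⟩ := (Fin.cycleRange ⟨k - 1, h⟩).surjective p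
  have ht : tP n k (Fin.cycleRange ⟨k - 1, h⟩ q) = q := by
    rw [tP, dif_pos h]
    exact Equiv.symm_apply_apply _ q
  rw [ht]
  rcases le_or_gt q ⟨k - 1, h⟩ with hq | hq
  · rw [Fin.coe_cycleRange_of_le hq]
    simp only [Fin.ext_iff, Fin.le_def] at hq ⊢
    split_ifs <;> first | contradiction | omega
  · rw [Fin.cycleRange_of_gt hq]
    simp only [Fin.lt_def] at hq
    split_ifs <;> omega

theorem tP_pow_apply_val {n k : ℕ} (hk1 : 1 ≤ k) (hkn : k ≤ n) (i : ℕ) (hik : i ≤ k)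
    (p : Fin n) :
    ((tP n k ^ i) p : ℕ) =
      if (p : ℕ) < k then (if (p : ℕ) < i then p + k - i else p - i) else p := by
  induction i with
  | zero => simp
  | succ i ih =>
    rw [pow_succ', Equiv.Perm.mul_apply, tP_apply_val hk1 hkn, ih (by omega)]
    split_ifs <;> omega

theorem len_mul_swap_of_lt {n : ℕ} (π : Equiv.Perm (Fin n)) (u v : Fin n)
    (huv : (v : ℕ) = u + 1) (h : π u < π v) : len (π * Equiv.swap u v) = len π + 1 := by
  have hne : u ≠ v := fun e => by simp [e] at huv
  have hset : (Finset.univ.filter fun p : Fin n × Fin n =>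
        p.1 < p.2 ∧ (π * Equiv.swap u v) p.2 < (π * Equiv.swap u v) p.1) =
      insert (u, v) ((Finset.univ.filter fun p : Fin n × Fin n =>
        p.1 < p.2 ∧ π p.2 < π p.1).map
          ((Equiv.swap u v).prodCongr (Equiv.swap u v)).toEmbedding) := by
    ext ⟨a, b⟩
    simp only [Finset.mem_insert, Finset.mem_map_equiv, Finset.mem_filter, Finset.mem_univ,
      true_and, Equiv.prodCongr_symm, Equiv.symm_swap, Equiv.prodCongr_apply, Prod.map_apply,
      Equiv.Perm.mul_apply, Prod.mk.injEq]
    simp only [Equiv.swap_apply_def]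
    simp only [Fin.lt_def, Fin.ext_iff] at *
    grind
  rw [len, hset, Finset.card_insert_of_notMem, Finset.card_map, len]
  simp only [Finset.mem_map_equiv, Finset.mem_filter, Finset.mem_univ, true_and,
    Equiv.prodCongr_symm, Equiv.symm_swap, Equiv.prodCongr_apply, Prod.map_apply,
    Equiv.swap_apply_left, Equiv.swap_apply_right]
  rintro ⟨h1, -⟩
  rw [Fin.lt_def] at h1
  omega

theorem len_mul_swap_of_gt {n : ℕ} (π : Equiv.Perm (Fin n)) (u v : Fin n)
    (huv : (v : ℕ) = u + 1) (h : π v < π u) : len (π * Equiv.swap u v) + 1 = len π := by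
  have := len_mul_swap_of_lt (π * Equiv.swap u v) u v huv (by simpa using h)
  rw [this.symm, mul_assoc, Equiv.swap_mul_self, mul_one]

/-- The shape of a partial product of an elementary element with smallest index `k₁`, largest
index `K` and exponent sum `S`: it permutes the first `K` positions, is increasing on the first
`S` positions and on the remaining ones, and starts the second run with the values
`0, 1, …, k₁ - S - 1`. -/
structure IsTwoRun {n : ℕ} (k₁ K S : ℕ) (σ : Equiv.Perm (Fin n)) : Prop where
  fixes : ∀ p : Fin n, K ≤ p → σ p = p
  maps_lt : ∀ p : Fin n, (p : ℕ) < K → (σ p : ℕ) < K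
  shift : ∀ p : Fin n, S ≤ p → (p : ℕ) < k₁ → (σ p : ℕ) = p - S
  le_of_lt : ∀ p : Fin n, (p : ℕ) < S → k₁ - S ≤ σ p
  mono_left : ∀ p q : Fin n, p < q → (q : ℕ) < S → σ p < σ q
  mono_right : ∀ p q : Fin n, S ≤ p → p < q → σ p < σ q
  last : ∀ p : Fin n, (p : ℕ) + 1 = S → (σ p : ℕ) + 1 = K

theorem isTwoRun_one {n : ℕ} (k₁ : ℕ) : IsTwoRun k₁ k₁ 0 (1 : Equiv.Perm (Fin n)) where
  fixes := by simp
  maps_lt := by simp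
  shift := by simp
  le_of_lt := by simp
  mono_left := by simp
  mono_right := by simp
  last := by simp

theorem IsTwoRun.tP_pow_mul {n k₁ K S K' i : ℕ} {σ : Equiv.Perm (Fin n)}
    (h : IsTwoRun k₁ K S σ) (hk : k₁ ≤ K) (hK : K ≤ K') (hn : K' ≤ n) (hi : 0 < i)
    (hiK : i < K') (hS : S + i ≤ k₁) : IsTwoRun k₁ K' (S + i) (tP n K' ^ i * σ) := by
  have hv : ∀ p, ((tP n K' ^ i * σ) p : ℕ) =
      if (σ p : ℕ) < K' then (if (σ p : ℕ) < i then σ p + K' - i else σ p - i) else σ p :=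
    fun p => tP_pow_apply_val (by omega) hn i hiK.le (σ p)
  have hfix : ∀ p : Fin n, K ≤ p → (σ p : ℕ) = p := fun p hp => by rw [h.fixes p hp]
  have hge : ∀ p : Fin n, S + i ≤ p → i ≤ σ p := by
    intro p hp
    have hb : S + i - 1 < n := by omega
    have h1 := h.shift ⟨S + i - 1, hb⟩ (by simp; omega) (by simp; omega)
    have h2 := h.mono_right ⟨S + i - 1, hb⟩ p (by simp; omega) (by simp [Fin.lt_def]; omega)
    simp only [Fin.lt_def] at h1 h2
    omega
  constructor
  · intro p hp
    have := hv p
    have := hfix p (by omega)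
    ext
    split_ifs at * <;> omega
  · intro p hp
    have := hv p
    have := hfix p
    have := h.maps_lt p
    split_ifs at * <;> omega
  · intro p hp hp'
    have := hv p
    have := h.shift p (by omega) hp'
    split_ifs at * <;> omega
  · intro p hp
    have := hv p
    have := h.shift p
    have := h.le_of_lt p
    split_ifs at * <;> omega
  · intro p q hpq hq
    have := hv p
    have := hv q
    have := h.shift p
    have := h.shift q
    have := h.le_of_lt p
    have := h.le_of_lt q
    have := h.maps_lt p
    have := h.mono_left p q hpq
    simp only [Fin.lt_def] at *
    split_ifs at * <;> omega
  · intro p q hp hpq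
    have := hv p
    have := hv q
    have := hge p hp
    have := hge q (by simp only [Fin.lt_def] at hpq; omega)
    have := h.mono_right p q (by omega) hpq
    simp only [Fin.lt_def] at *
    split_ifs at * <;> omega
  · intro p hp
    have := hv p
    have := h.shift p (by omega) (by omega)
    split_ifs at * <;> omega

theorem IsTwoRun.lt_iff {n k₁ K S : ℕ} {σ : Equiv.Perm (Fin n)} (h : IsTwoRun k₁ K S σ)
    (hSK : S < K) (u v : Fin n) (huv : (v : ℕ) = u + 1) : σ v < σ u ↔ (v : ℕ) = S := by
  have hlt : u < v := by rw [Fin.lt_def]; omega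
  constructor
  · intro hd
    by_contra hne
    rcases lt_or_ge (v : ℕ) S with hv | hv
    · exact (h.mono_left u v hlt hv).not_gt hd
    · exact (h.mono_right u v (by omega) hlt).not_gt hd
  · intro hv
    have h1 := h.last u (by omega)
    have h2 := h.maps_lt v (by omega)
    have h3 : (σ u : ℕ) ≠ σ v := fun e => hlt.ne (σ.injective (Fin.ext e))
    rw [Fin.lt_def]
    omega

theorem ogsProd_one_succ {n : ℕ} (m : ℕ) (f : ℕ → Equiv.Perm (Fin n)) :
    ogsProd 1 (m + 1) f = f (m + 1) * ogsProd 1 m f := by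
  simp [ogsProd, List.range'_1_concat, add_comm]

theorem isTwoRun_ogsProd (n : ℕ) (k i : ℕ → ℕ) (m : ℕ) (hm : 1 ≤ m)
    (hk : ∀ j, 1 ≤ j → j ≤ m → k j ≤ n)
    (hmono : ∀ j, 1 ≤ j → j < m → k j < k (j + 1))
    (hi : ∀ j, 1 ≤ j → j ≤ m → 0 < i j ∧ i j < k j)
    (hsum : ∑ j ∈ Finset.Icc 1 m, i j ≤ k 1) :
    k 1 ≤ k m ∧ ∑ j ∈ Finset.Icc 1 m, i j < k m ∧
      IsTwoRun (k 1) (k m) (∑ j ∈ Finset.Icc 1 m, i j)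
        (ogsProd 1 m fun j => tP n (k j) ^ i j) := by
  induction m, hm using Nat.le_induction with
  | base =>
    have h := (isTwoRun_one (n := n) (k 1)).tP_pow_mul le_rfl le_rfl (hk 1 le_rfl le_rfl)
      (hi 1 le_rfl le_rfl).1 (hi 1 le_rfl le_rfl).2 (by simpa using hsum)
    rw [zero_add, mul_one] at h
    simpa [ogsProd] using ⟨(hi 1 le_rfl le_rfl).2, h⟩
  | succ m hm ih =>
    rw [Finset.sum_Icc_succ_top (by omega)] at hsum ⊢
    obtain ⟨h1, h2, h3⟩ := ih (fun j a b => hk j a (by omega)) (fun j a b => hmono j a (by omega))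
      (fun j a b => hi j a (by omega)) (by omega)
    have hlt := hmono m hm (by omega)
    have hi' := hi (m + 1) (by omega) le_rfl
    rw [ogsProd_one_succ]
    exact ⟨by omega, by omega,
      h3.tP_pow_mul h1 hlt.le (hk _ (by omega) le_rfl) hi'.1 hi'.2 hsum⟩

/-- If `π = ∏_{j=1}^{m} t_{k_j}^{i_j}` is a standard OGS elementary
element of `Sₙ`, then `des(π) = {Σ_{j=1}^{m} i_j}`; equivalently, for `1 ≤ r ≤ n−1`,
`ℓ(s_r·π) = ℓ(π)−1` if `r = Σ i_j` and `ℓ(s_r·π) = ℓ(π)+1` otherwise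
(the paper product `s_r·π` is encoded as `π * sP n r`). -/
theorem elementary_descent (n m : ℕ) (k i : ℕ → ℕ) (hm : 1 ≤ m)
    (hk : ∀ j, 1 ≤ j → j ≤ m → 2 ≤ k j ∧ k j ≤ n)
    (hmono : ∀ j, 1 ≤ j → j < m → k j < k (j + 1))
    (hi : ∀ j, 1 ≤ j → j ≤ m → 0 < i j ∧ i j < k j)
    (hsum : ∑ j ∈ Finset.Icc 1 m, i j ≤ k 1)
    (π : Equiv.Perm (Fin n)) (hπ : π = ogsProd 1 m fun j => tP n (k j) ^ i j) :
    descents π = {∑ j ∈ Finset.Icc 1 m, i j} ∧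
    ∀ r, 1 ≤ r → r ≤ n - 1 →
      (r = ∑ j ∈ Finset.Icc 1 m, i j → len (π * sP n r) + 1 = len π) ∧
      (r ≠ ∑ j ∈ Finset.Icc 1 m, i j → len (π * sP n r) = len π + 1) := by
  obtain ⟨-, hlt, h⟩ := isTwoRun_ogsProd n k i m hm (fun j a b => (hk j a b).2) hmono hi hsum
  rw [← hπ] at h
  have hkn := (hk m hm le_rfl).2
  have hpos : 1 ≤ ∑ j ∈ Finset.Icc 1 m, i j :=
    (hi 1 le_rfl hm).1.trans_le
      (Finset.single_le_sum (fun _ _ => Nat.zero_le _) (Finset.mem_Icc.2 ⟨le_rfl, hm⟩))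
  generalize ∑ j ∈ Finset.Icc 1 m, i j = S at *
  have key : ∀ r (hr : r < n), 1 ≤ r →
      (π ⟨r, hr⟩ < π ⟨r - 1, by omega⟩ ↔ r = S) := fun r hr h1 =>
    h.lt_iff hlt ⟨r - 1, by omega⟩ ⟨r, hr⟩ (by simp; omega)
  refine ⟨?_, fun r h1 hr => ?_⟩
  · ext r
    simp only [descents, Finset.mem_filter, Finset.mem_Ico, Finset.mem_singleton]
    constructor
    · rintro ⟨⟨h1, hr⟩, _, hd⟩
      exact (key r hr h1).1 hd
    · rintro rfl
      exact ⟨⟨hpos, by omega⟩, by omega, (key r (by omega) hpos).2 rfl⟩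
  · have hrn : r < n := by omega
    rw [sP, dif_pos hrn]
    refine ⟨fun e => len_mul_swap_of_gt π _ _ (by simp; omega) ((key r hrn h1).2 e),
      fun e => len_mul_swap_of_lt π _ _ (by simp; omega) ?_⟩
    refine lt_of_le_of_ne (not_lt.1 fun hd => e ((key r hrn h1).1 hd)) fun hEq => ?_
    have := congrArg Fin.val (π.injective hEq)
    simp only at this
    omega
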